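/- Let X₀ > 0, K > 0, r ∈ ℝ, t > 0, and let Y_t be a normally distributed real random variable with mean μ and standard deviation σ_{Y_t} > 0 satisfying the no-arbitrage condition E[e^{Y_t}] = e^{rt} (equivalently, E[X_t] = X₀ e^{rt} where X_t = X₀ e^{Y_t}). Then the discounted expected payoff of the European call option, C = e^{−rt} E[max(X₀ e^{Y_t} − K, 0)], equals X₀·N(d₊) − K e^{−rt}·N(d₋), where d₊ = (1/σ_{Y_t}) log(e^{rt} X₀ / K) + σ_{Y_t}/2 and d₋ = (1/σ_{Y_t}) log(e^{rt} X₀ / K) − σ_{Y_t}/2. -/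

import Mathlib

open MeasureTheory ProbabilityTheory Real

/-- The standard normal cumulative distribution function
`N(x) = (1/√(2π)) ∫_{−∞}^{x} e^{−y²/2} dy`. -/
noncomputable def stdNormalCDF (x : ℝ) : ℝ :=
  (gaussianReal 0 1 (Set.Iic x)).toReal

/-- The upper tail of a Gaussian measure in terms of the standard normal CDF. -/
lemma gaussianReal_real_Ici (m a : ℝ) {σ : ℝ} (hσ : 0 < σ) :
    (gaussianReal m (σ ^ 2).toNNReal).real (Set.Ici a) = stdNormalCDF ((m - a) / σ) := by
  have hmap : (gaussianReal m (σ ^ 2).toNNReal).map (fun x ↦ (m - x) / σ) = gaussianReal 0 1 := by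
    have hcomp : (fun x : ℝ ↦ (m - x) / σ) = (fun x ↦ x / σ) ∘ (fun x ↦ m - x) := rfl
    rw [hcomp, ← Measure.map_map (by fun_prop) (by fun_prop), gaussianReal_map_const_sub,
      gaussianReal_map_div_const]
    congr 1
    · simp
    · ext
      simp [Real.coe_toNNReal _ (sq_nonneg σ), hσ.ne']
  rw [stdNormalCDF, ← hmap, Measure.map_apply (by fun_prop) measurableSet_Iic, Measure.real]
  congr 2
  ext x
  simp only [Set.mem_Ici, Set.mem_preimage, Set.mem_Iic, div_le_div_iff_of_pos_right hσ,
    sub_le_sub_iff_left]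

/-- Exponential tilting shifts the mean of a Gaussian measure by its variance. -/
lemma setIntegral_exp_gaussianReal (m : ℝ) {v : NNReal} (hv : v ≠ 0) {s : Set ℝ}
    (hs : MeasurableSet s) :
    ∫ x in s, Real.exp x ∂gaussianReal m v
      = Real.exp (m + v / 2) * (gaussianReal (m + v) v).real s := by
  rw [← integral_indicator hs, integral_gaussianReal_eq_integral_smul hv, Measure.real,
    gaussianReal_apply_eq_integral _ hv, ENNReal.toReal_ofReal
      (integral_nonneg fun x ↦ gaussianPDFReal_nonneg _ _ _), ← integral_const_mul,
    ← integral_indicator hs]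
  congr 1 with x
  by_cases hx : x ∈ s
  · have hv' : (v : ℝ) ≠ 0 := by exact_mod_cast hv
    simp only [hx, Set.indicator_of_mem, smul_eq_mul, gaussianPDFReal]
    rw [mul_assoc, ← Real.exp_add, mul_left_comm, ← Real.exp_add]
    congr 2
    field_simp
    ring
  · simp [hx]

/-- Black–Scholes pricing of a European call option. If the time-`t` log-return `Y_t`
is normal with standard deviation `σ > 0` and the no-arbitrage condition
`E[e^{Y_t}] = e^{rt}` holds, then the discounted price
`C = e^{−rt} E[max(X₀ e^{Y_t} − K, 0)]` equals `X₀ N(d₊) − K e^{−rt} N(d₋)` with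
`d± = (1/σ) log(e^{rt} X₀/K) ± σ/2`. -/
theorem black_scholes_call_price
    {Ω : Type*} [MeasurableSpace Ω] (P : Measure Ω) [IsProbabilityMeasure P]
    (Y : Ω → ℝ) (hYmeas : Measurable Y)
    (X₀ K r t μ σ : ℝ) (hX₀ : 0 < X₀) (hK : 0 < K) (ht : 0 < t) (hσ : 0 < σ)
    (hY : Measure.map Y P = gaussianReal μ (σ ^ 2).toNNReal)
    (hNoArb : ∫ ω, Real.exp (Y ω) ∂P = Real.exp (r * t)) :
    Real.exp (-(r * t)) * ∫ ω, max (X₀ * Real.exp (Y ω) - K) 0 ∂P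
      = X₀ * stdNormalCDF ((1 / σ) * Real.log (Real.exp (r * t) * X₀ / K) + σ / 2)
        - K * Real.exp (-(r * t))
            * stdNormalCDF ((1 / σ) * Real.log (Real.exp (r * t) * X₀ / K) - σ / 2) := by
  set v : NNReal := (σ ^ 2).toNNReal with hv_def
  have hv_coe : (v : ℝ) = σ ^ 2 := Real.coe_toNNReal _ (sq_nonneg σ)
  have hv : v ≠ 0 := by
    rw [← NNReal.coe_ne_zero, hv_coe]
    positivity
  have hdrift : μ + σ ^ 2 / 2 = r * t := by
    have h := mgf_gaussianReal hY 1
    simp only [mgf, one_mul, hNoArb, hv_coe, mul_one, one_pow] at h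
    exact (Real.exp_injective h).symm
  have hexp : Integrable (fun x ↦ Real.exp x) (gaussianReal μ v) := by
    simpa using integrable_exp_mul_gaussianReal (μ := μ) (v := v) 1
  set a : ℝ := Real.log (K / X₀) with ha
  have hpayoff : (fun x ↦ max (X₀ * Real.exp x - K) 0)
      = (Set.Ici a).indicator (fun x ↦ X₀ * Real.exp x - K) := by
    ext x
    have hmem : x ∈ Set.Ici a ↔ 0 ≤ X₀ * Real.exp x - K := by
      rw [Set.mem_Ici, ha, Real.log_le_iff_le_exp (by positivity), div_le_iff₀' hX₀, sub_nonneg]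
    by_cases hx : x ∈ Set.Ici a
    · rw [Set.indicator_of_mem hx, max_eq_left (hmem.1 hx)]
    · rw [Set.indicator_of_notMem hx, max_eq_right (not_le.1 (mt hmem.2 hx)).le]
  have hlog : Real.log (Real.exp (r * t) * X₀ / K) = r * t - a := by
    rw [ha, Real.log_div (by positivity) hX₀.ne', Real.log_div (by positivity) hK.ne',
      Real.log_mul (by positivity) hX₀.ne', Real.log_exp]
    ring
  have hintegral : ∫ ω, max (X₀ * Real.exp (Y ω) - K) 0 ∂P
      = X₀ * (Real.exp (r * t) * stdNormalCDF ((μ + σ ^ 2 - a) / σ))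
        - K * stdNormalCDF ((μ - a) / σ) := by
    rw [← integral_map (φ := Y) (f := fun x ↦ max (X₀ * Real.exp x - K) 0) hYmeas.aemeasurable
        (by fun_prop), hY, hpayoff, integral_indicator measurableSet_Ici,
      integral_sub (hexp.integrableOn.const_mul X₀) (integrable_const K), integral_const_mul,
      setIntegral_exp_gaussianReal _ hv measurableSet_Ici, setIntegral_const, smul_eq_mul,
      hv_coe, hdrift, gaussianReal_real_Ici _ _ hσ, gaussianReal_real_Ici _ _ hσ, mul_comm K]
  have hplus : (μ + σ ^ 2 - a) / σ = 1 / σ * (r * t - a) + σ / 2 := by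
    rw [← hdrift]
    field_simp
    ring
  have hminus : (μ - a) / σ = 1 / σ * (r * t - a) - σ / 2 := by
    rw [← hdrift]
    field_simp
    ring
  have hdiscount : Real.exp (-(r * t)) * Real.exp (r * t) = 1 := by
    rw [← Real.exp_add, neg_add_cancel, Real.exp_zero]
  rw [hintegral, hlog, ← hplus, ← hminus]
  linear_combination X₀ * stdNormalCDF ((μ + σ ^ 2 - a) / σ) * hdiscount
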